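/- arXiv:2402.04963 — 6 statements merged into one kernel-verified Lean document; each statement's English description precedes it below -/
import Mathlib

section
/- Under these hypotheses, the bathtub system admits exactly one solution: there exists a unique pair of continuous functions z, H : [0,T̄] → ℝ such that z(t) = ∫₀ᵗ V(H(s)) ds and H(t) = h(z(t)) + ∫₀ᵗ F̄(z(t) − z(s), s) ds for all t ∈ [0,T̄]. -/
open MeasureTheory Set

/-- Iterates of a map satisfying a Volterra-type Lipschitz estimate obey the factorial bound. -/
theorem abs_iterate_sub_le_of_volterra {T C : ℝ} (hT : 0 ≤ T) (hC : 0 ≤ C)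
    {Φ : C(Icc (0 : ℝ) T, ℝ) → C(Icc (0 : ℝ) T, ℝ)}
    (hΦ : ∀ f g : C(Icc (0 : ℝ) T, ℝ), ∀ t : Icc (0 : ℝ) T, |Φ f t - Φ g t| ≤
      C * ∫ s in (0 : ℝ)..t, |IccExtend hT f s - IccExtend hT g s|)
    (f g : C(Icc (0 : ℝ) T, ℝ)) (n : ℕ) (t : Icc (0 : ℝ) T) :
    |Φ^[n] f t - Φ^[n] g t| ≤ (C * t) ^ n / n.factorial * dist f g := by
  induction n generalizing t with
  | zero => simpa [Real.dist_eq] using ContinuousMap.dist_apply_le_dist (f := f) (g := g) t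
  | succ n ih =>
    rw [Function.iterate_succ_apply', Function.iterate_succ_apply']
    refine (hΦ _ _ t).trans ?_
    have hcont : ∀ u : C(Icc (0 : ℝ) T, ℝ), Continuous (IccExtend hT u) :=
      fun u => u.continuous.Icc_extend'
    have hle : ∫ s in (0 : ℝ)..t, |IccExtend hT (Φ^[n] f) s - IccExtend hT (Φ^[n] g) s| ≤
        ∫ s in (0 : ℝ)..t, C ^ n / n.factorial * dist f g * s ^ n := by
      refine intervalIntegral.integral_mono_on t.2.1
        (((hcont _).sub (hcont _)).abs.intervalIntegrable _ _)
        ((by fun_prop : Continuous fun s : ℝ =>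
          C ^ n / n.factorial * dist f g * s ^ n).intervalIntegrable _ _) fun s hs => ?_
      have hs' : s ∈ Icc (0 : ℝ) T := ⟨hs.1, hs.2.trans t.2.2⟩
      rw [IccExtend_of_mem hT _ hs', IccExtend_of_mem hT _ hs']
      refine (ih ⟨s, hs'⟩).trans_eq ?_
      rw [mul_pow]
      ring
    refine (mul_le_mul_of_nonneg_left hle hC).trans_eq ?_
    rw [intervalIntegral.integral_const_mul, integral_pow, Nat.factorial_succ]
    have := Nat.factorial_ne_zero n
    push_cast
    field_simp
    ring

/-- A self-map of `C([0, T])` satisfying a Volterra-type Lipschitz estimate has a contracting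
iterate. -/
theorem exists_contractingWith_iterate_of_volterra {T C : ℝ} (hT : 0 ≤ T) (hC : 0 ≤ C)
    {Φ : C(Icc (0 : ℝ) T, ℝ) → C(Icc (0 : ℝ) T, ℝ)}
    (hΦ : ∀ f g : C(Icc (0 : ℝ) T, ℝ), ∀ t : Icc (0 : ℝ) T, |Φ f t - Φ g t| ≤
      C * ∫ s in (0 : ℝ)..t, |IccExtend hT f s - IccExtend hT g s|) :
    ∃ (n : ℕ) (K : NNReal), ContractingWith K Φ^[n] := by
  obtain ⟨n, hn⟩ := ((FloorSemiring.tendsto_pow_div_factorial_atTop (C * T)).eventually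
    (gt_mem_nhds one_pos)).exists
  have hnonneg : 0 ≤ (C * T) ^ n / n.factorial := by positivity
  refine ⟨n, ⟨(C * T) ^ n / n.factorial, hnonneg⟩, hn, LipschitzWith.of_dist_le_mul fun f g => ?_⟩
  refine (ContinuousMap.dist_le (by positivity)).2 fun t => ?_
  rw [Real.dist_eq]
  refine (abs_iterate_sub_le_of_volterra hT hC hΦ f g n t).trans ?_
  have := t.2.1
  have := t.2.2
  change _ ≤ (C * T) ^ n / n.factorial * dist f g
  gcongr

/-- Volterra-type fixed point equations on `[0, T]` have exactly one continuous solution. -/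
theorem exists_unique_fixed_of_volterra {T C : ℝ} (hT : 0 ≤ T) (hC : 0 ≤ C)
    {G : (ℝ → ℝ) → ℝ → ℝ}
    (hcont : ∀ f, ContinuousOn f (Icc 0 T) → ContinuousOn (G f) (Icc 0 T))
    (hG : ∀ f g, ContinuousOn f (Icc 0 T) → ContinuousOn g (Icc 0 T) → ∀ t ∈ Icc (0 : ℝ) T,
      |G f t - G g t| ≤ C * ∫ s in (0 : ℝ)..t, |f s - g s|) :
    ∃ f, ContinuousOn f (Icc 0 T) ∧ EqOn f (G f) (Icc 0 T) ∧
      ∀ g, ContinuousOn g (Icc 0 T) → EqOn g (G g) (Icc 0 T) → EqOn g f (Icc 0 T) := by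
  have hext : ∀ u : C(Icc (0 : ℝ) T, ℝ), ContinuousOn (IccExtend hT u) (Icc 0 T) :=
    fun u => u.continuous.Icc_extend'.continuousOn
  let Φ : C(Icc (0 : ℝ) T, ℝ) → C(Icc (0 : ℝ) T, ℝ) := fun u =>
    ⟨(Icc 0 T).domRestrict (G (IccExtend hT u)), (hcont _ (hext u)).domRestrict⟩
  obtain ⟨n, K, hK⟩ := exists_contractingWith_iterate_of_volterra (Φ := Φ) hT hC
    fun u v t => hG _ _ (hext u) (hext v) t t.2
  have hfix : Function.IsFixedPt Φ (ContractingWith.fixedPoint Φ^[n] hK) :=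
    hK.isFixedPt_fixedPoint_iterate
  set u := ContractingWith.fixedPoint Φ^[n] hK
  refine ⟨IccExtend hT u, hext u, fun t ht => ?_, fun g hg hgG t ht => ?_⟩
  · rw [IccExtend_of_mem hT _ ht]
    exact (DFunLike.congr_fun hfix ⟨t, ht⟩).symm
  · let w : C(Icc (0 : ℝ) T, ℝ) := ⟨(Icc 0 T).domRestrict g, hg.domRestrict⟩
    have hw : Function.IsFixedPt Φ w := by
      ext ⟨s, hs⟩
      have hzero : ∫ r in (0 : ℝ)..s, |IccExtend hT w r - g r| = 0 := by
        rw [intervalIntegral.integral_congr (g := fun _ => (0 : ℝ)) fun r hr => ?_]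
        · simp
        · rw [uIcc_of_le hs.1] at hr
          have hr' : r ∈ Icc (0 : ℝ) T := ⟨hr.1, hr.2.trans hs.2⟩
          simp only [IccExtend_of_mem hT _ hr']
          exact abs_eq_zero.2 (sub_self (g r))
      have hle := hG _ _ (hext w) hg s hs
      rw [hzero, mul_zero] at hle
      have heq : G (IccExtend hT w) s = G g s :=
        sub_eq_zero.1 (abs_nonpos_iff.1 hle)
      exact heq.trans (hgG hs).symm
    have hwu : w = u := hK.fixedPoint_unique (hw.iterate n)
    rw [IccExtend_of_mem hT _ ht, ← hwu]
    rfl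

section Kernel

variable {T MF : ℝ} {LF : NNReal} {F : ℝ → ℝ → ℝ} {z w : ℝ → ℝ}

theorem intervalIntegrable_kernel (hFb : ∀ x : ℝ, ∀ s ∈ Icc (0 : ℝ) T, |F x s| ≤ MF)
    (hFm : Measurable (Function.uncurry F)) (hz : ContinuousOn z (Icc 0 T)) (x : ℝ) {a b : ℝ}
    (ha : a ∈ Icc (0 : ℝ) T) (hb : b ∈ Icc (0 : ℝ) T) :
    IntervalIntegrable (fun s => F (x - z s) s) volume a b := by
  have hint : IntegrableOn (fun s => F (x - z s) s) (Icc 0 T) := by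
    refine Integrable.of_bound ?_ MF ?_
    · have hzm : AEMeasurable z (volume.restrict (Icc 0 T)) := hz.aemeasurable measurableSet_Icc
      exact (hFm.comp_aemeasurable
        ((hzm.const_sub x).prodMk aemeasurable_id)).aestronglyMeasurable
    · exact (ae_restrict_iff' measurableSet_Icc).2 (.of_forall fun s hs => hFb _ s hs)
  exact (hint.mono_set (uIcc_subset_Icc ha hb)).intervalIntegrable

theorem abs_integral_kernel_sub_le (hFb : ∀ x : ℝ, ∀ s ∈ Icc (0 : ℝ) T, |F x s| ≤ MF)
    (hFm : Measurable (Function.uncurry F))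
    (hFL : ∀ s ∈ Icc (0 : ℝ) T, LipschitzWith LF (fun x => F x s))
    (hz : ContinuousOn z (Icc 0 T)) (hw : ContinuousOn w (Icc 0 T)) {x y ε t : ℝ}
    (ht : t ∈ Icc (0 : ℝ) T) (hε : ∀ s ∈ Icc (0 : ℝ) t, |(x - z s) - (y - w s)| ≤ ε) :
    |(∫ s in (0 : ℝ)..t, F (x - z s) s) - ∫ s in (0 : ℝ)..t, F (y - w s) s| ≤ LF * ε * t := by
  have h0 : (0 : ℝ) ∈ Icc (0 : ℝ) T := ⟨le_rfl, ht.1.trans ht.2⟩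
  rw [← intervalIntegral.integral_sub (intervalIntegrable_kernel hFb hFm hz x h0 ht)
    (intervalIntegrable_kernel hFb hFm hw y h0 ht)]
  have hle := intervalIntegral.norm_integral_le_of_norm_le_const (a := (0 : ℝ)) (b := t)
    (f := fun s => F (x - z s) s - F (y - w s) s) (C := LF * ε) fun s hs => ?_
  · rwa [sub_zero, abs_of_nonneg ht.1, Real.norm_eq_abs] at hle
  · rw [uIoc_of_le ht.1] at hs
    refine ((hFL s ⟨hs.1.le, hs.2.trans ht.2⟩).dist_le_mul _ _).trans ?_
    exact mul_le_mul_of_nonneg_left (hε s ⟨hs.1.le, hs.2⟩) LF.2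

theorem continuousOn_integral_kernel (hFb : ∀ x : ℝ, ∀ s ∈ Icc (0 : ℝ) T, |F x s| ≤ MF)
    (hFm : Measurable (Function.uncurry F))
    (hFL : ∀ s ∈ Icc (0 : ℝ) T, LipschitzWith LF (fun x => F x s))
    (hz : ContinuousOn z (Icc 0 T)) :
    ContinuousOn (fun t => ∫ s in (0 : ℝ)..t, F (z t - z s) s) (Icc 0 T) := by
  intro t ht
  have hz_t : Filter.Tendsto z (nhdsWithin t (Icc 0 T)) (nhds (z t)) := hz t ht
  have h_id : Filter.Tendsto (fun r : ℝ => r) (nhdsWithin t (Icc 0 T)) (nhds t) :=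
    continuousWithinAt_id
  have hbound : Filter.Tendsto (fun r => LF * |z r - z t| * r + MF * |r - t|)
      (nhdsWithin t (Icc 0 T)) (nhds 0) := by
    have := (((hz_t.sub_const (z t)).abs.const_mul (LF : ℝ)).mul h_id).add
      ((h_id.sub_const t).abs.const_mul MF)
    simpa using this
  refine tendsto_iff_dist_tendsto_zero.2 (squeeze_zero' (.of_forall fun _ => dist_nonneg) ?_ hbound)
  filter_upwards [self_mem_nhdsWithin] with r hr
  have h0 : (0 : ℝ) ∈ Icc (0 : ℝ) T := ⟨le_rfl, hr.1.trans hr.2⟩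
  refine (dist_triangle _ (∫ s in (0 : ℝ)..r, F (z t - z s) s) _).trans (add_le_add ?_ ?_)
  · exact abs_integral_kernel_sub_le hFb hFm hFL hz hz hr fun s _ => by
      rw [sub_sub_sub_cancel_right]
  · rw [Real.dist_eq, intervalIntegral.integral_interval_sub_left
      (intervalIntegrable_kernel hFb hFm hz _ h0 hr) (intervalIntegrable_kernel hFb hFm hz _ h0 ht)]
    refine intervalIntegral.norm_integral_le_of_norm_le_const (C := MF)
      (f := fun s => F (z t - z s) s) fun s hs => hFb _ s ?_
    exact uIcc_subset_Icc ht hr (uIoc_subset_uIcc hs)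

end Kernel

theorem abs_integral_comp_sub_le {T : ℝ} {V f g : ℝ → ℝ} {LV : NNReal} (hV : LipschitzWith LV V)
    (hf : ContinuousOn f (Icc 0 T)) (hg : ContinuousOn g (Icc 0 T)) {s t : ℝ}
    (hs : 0 ≤ s) (hst : s ≤ t) (ht : t ≤ T) :
    |(∫ r in (0 : ℝ)..s, V (f r)) - ∫ r in (0 : ℝ)..s, V (g r)| ≤
      LV * ∫ r in (0 : ℝ)..t, |f r - g r| := by
  have hint : ∀ {u : ℝ → ℝ} {b : ℝ}, 0 ≤ b → b ≤ T → ContinuousOn u (Icc 0 T) →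
      IntervalIntegrable u volume 0 b := fun hb hbT hu =>
    (hu.mono (uIcc_of_le hb ▸ Icc_subset_Icc_right hbT)).intervalIntegrable
  have habs : ContinuousOn (fun r => |f r - g r|) (Icc 0 T) := (hf.sub hg).abs
  have hsT := hst.trans ht
  rw [← intervalIntegral.integral_sub (hint hs hsT (hV.continuous.comp_continuousOn' hf))
    (hint hs hsT (hV.continuous.comp_continuousOn' hg))]
  calc |∫ r in (0 : ℝ)..s, V (f r) - V (g r)|
      ≤ ∫ r in (0 : ℝ)..s, LV * |f r - g r| :=
        intervalIntegral.norm_integral_le_of_norm_le (f := fun r => V (f r) - V (g r))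
          (g := fun r => LV * |f r - g r|) hs
          (.of_forall fun r _ => hV.dist_le_mul (f r) (g r)) ((hint hs hsT habs).const_mul _)
    _ = LV * ∫ r in (0 : ℝ)..s, |f r - g r| := intervalIntegral.integral_const_mul _ _
    _ ≤ LV * ∫ r in (0 : ℝ)..t, |f r - g r| := by
        refine mul_le_mul_of_nonneg_left ?_ LV.2
        exact intervalIntegral.integral_mono_interval le_rfl hs hst
          (.of_forall fun _ => abs_nonneg _) (hint (hs.trans hst) ht habs)

/-- Existence and uniqueness of the solution of the bathtub system
`z(t) = ∫₀ᵗ V(H(s)) ds`, `H(t) = h(z(t)) + ∫₀ᵗ F̄(z(t) − z(s), s) ds` on `[0, T̄]`. -/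
theorem bathtub_existence_uniqueness
    (Tbar Vmin Vmax : ℝ) (hT : 0 < Tbar) (hVmin : 0 < Vmin) (hVV : Vmin ≤ Vmax)
    (V : ℝ → ℝ) (LV : NNReal) (hVLip : LipschitzWith LV V)
    (hVbound : ∀ y, Vmin ≤ V y ∧ V y ≤ Vmax)
    (h : ℝ → ℝ) (Mh : ℝ) (hhBound : ∀ x, |h x| ≤ Mh)
    (Lh : NNReal) (hhLip : LipschitzWith Lh h)
    (Fb : ℝ → ℝ → ℝ) (MF : ℝ)
    (hFBound : ∀ x : ℝ, ∀ s ∈ Icc (0 : ℝ) Tbar, |Fb x s| ≤ MF)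
    (hFmeas : Measurable (Function.uncurry Fb))
    (LF : NNReal) (hFLip : ∀ s ∈ Icc (0 : ℝ) Tbar, LipschitzWith LF (fun x => Fb x s)) :
    ∃ z H : ℝ → ℝ,
      (ContinuousOn z (Icc 0 Tbar) ∧ ContinuousOn H (Icc 0 Tbar) ∧
        (∀ t ∈ Icc (0 : ℝ) Tbar, z t = ∫ s in (0 : ℝ)..t, V (H s)) ∧
        (∀ t ∈ Icc (0 : ℝ) Tbar, H t = h (z t) + ∫ s in (0 : ℝ)..t, Fb (z t - z s) s)) ∧
      ∀ z' H' : ℝ → ℝ,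
        (ContinuousOn z' (Icc 0 Tbar) ∧ ContinuousOn H' (Icc 0 Tbar) ∧
          (∀ t ∈ Icc (0 : ℝ) Tbar, z' t = ∫ s in (0 : ℝ)..t, V (H' s)) ∧
          (∀ t ∈ Icc (0 : ℝ) Tbar, H' t = h (z' t) + ∫ s in (0 : ℝ)..t, Fb (z' t - z' s) s)) →
        ∀ t ∈ Icc (0 : ℝ) Tbar, z' t = z t ∧ H' t = H t := by
  let Z : (ℝ → ℝ) → ℝ → ℝ := fun f t => ∫ s in (0 : ℝ)..t, V (f s)
  let G : (ℝ → ℝ) → ℝ → ℝ := fun f t =>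
    h (Z f t) + ∫ s in (0 : ℝ)..t, Fb (Z f t - Z f s) s
  have hZ : ∀ f, ContinuousOn f (Icc 0 Tbar) → ContinuousOn (Z f) (Icc 0 Tbar) := fun f hf => by
    have hVf : ContinuousOn (fun s => V (f s)) (Icc 0 Tbar) := hVLip.continuous.comp_continuousOn hf
    have hprim := intervalIntegral.continuousOn_primitive_interval (μ := volume) (a := 0)
      (b := Tbar) (f := fun s => V (f s))
    rw [uIcc_of_le hT.le] at hprim
    exact hprim hVf.integrableOn_Icc
  have hGcont : ∀ f, ContinuousOn f (Icc 0 Tbar) → ContinuousOn (G f) (Icc 0 Tbar) := fun f hf =>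
    (hhLip.continuous.comp_continuousOn (hZ f hf)).add
      (continuousOn_integral_kernel hFBound hFmeas hFLip (hZ f hf))
  have hG : ∀ f g, ContinuousOn f (Icc 0 Tbar) → ContinuousOn g (Icc 0 Tbar) →
      ∀ t ∈ Icc (0 : ℝ) Tbar, |G f t - G g t| ≤
        (LV * (Lh + 2 * LF * Tbar) : ℝ) * ∫ s in (0 : ℝ)..t, |f s - g s| := by
    intro f g hf hg t ht
    set D := ∫ s in (0 : ℝ)..t, |f s - g s|
    have hD : 0 ≤ D := intervalIntegral.integral_nonneg ht.1 fun _ _ => abs_nonneg _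
    have hZle : ∀ s ∈ Icc (0 : ℝ) t, |Z f s - Z g s| ≤ LV * D := fun s hs =>
      abs_integral_comp_sub_le hVLip hf hg hs.1 hs.2 ht.2
    have hZt := hZle t ⟨ht.1, le_rfl⟩
    have h_kernel := abs_integral_kernel_sub_le hFBound hFmeas hFLip (hZ f hf) (hZ g hg)
      (x := Z f t) (y := Z g t) (ε := 2 * (LV * D)) ht fun s hs => by
        rw [sub_sub_sub_comm, two_mul]
        exact (abs_sub _ _).trans (add_le_add hZt (hZle s hs))
    have h_h : |h (Z f t) - h (Z g t)| ≤ Lh * (LV * D) :=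
      (hhLip.dist_le_mul _ _).trans (mul_le_mul_of_nonneg_left hZt Lh.2)
    calc |G f t - G g t| ≤ Lh * (LV * D) + LF * (2 * (LV * D)) * t := by
          simp only [G]
          rw [add_sub_add_comm]
          exact (abs_add_le _ _).trans (add_le_add h_h h_kernel)
      _ ≤ Lh * (LV * D) + LF * (2 * (LV * D)) * Tbar := by gcongr; exact ht.2
      _ = LV * (Lh + 2 * LF * Tbar) * D := by ring
  obtain ⟨H, hHc, hHG, hHu⟩ :=
    exists_unique_fixed_of_volterra hT.le (by positivity) hGcont hG
  refine ⟨Z H, H, ⟨hZ H hHc, hHc, fun _ _ => rfl, hHG⟩, ?_⟩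
  rintro z' H' ⟨-, hHc', hz', hH'⟩
  have hzZ : EqOn z' (Z H') (Icc 0 Tbar) := hz'
  have heq : EqOn H' H (Icc 0 Tbar) := hHu H' hHc' fun t ht => by
    rw [hH' t ht, hzZ ht]
    refine congrArg (h (Z H' t) + ·) (intervalIntegral.integral_congr fun s hs => ?_)
    rw [uIcc_of_le ht.1] at hs
    simp only [hzZ ⟨hs.1, hs.2.trans ht.2⟩]
  intro t ht
  refine ⟨(hz' t ht).trans (intervalIntegral.integral_congr fun s hs => ?_), heq ht⟩
  rw [uIcc_of_le ht.1] at hs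
  simp only [heq ⟨hs.1, hs.2.trans ht.2⟩]
end

section
/- There exists a constant C, depending only on T̄, Vmin, Vmax, the Lipschitz constants of V, h₁, and of F̄₁ in its first argument, and the uniform bound on F̄₁, such that the following holds: if (z₁, H₁) solves the bathtub system with data (h₁, F̄₁) and (z₂, H₂) solves it with data (h₂, F̄₂), where both data pairs satisfy the stated regularity and bounds, then sup_{t∈[0,T̄]} |z₁(t) − z₂(t)| + sup_{t∈[0,T̄]} |H₁(t) − H₂(t)| ≤ C·( sup_{x∈ℝ} |h₁(x) − h₂(x)| + sup_{(x,s)∈ℝ×[0,T̄]} |F̄₁(x,s) − F̄₂(x,s)| ). In particular the solution of the bathtub system depends Lipschitz continuously on the initial condition h and on the demand F̄. -/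
open MeasureTheory Set

/-- Grönwall's inequality in integral form. -/
lemma integral_le_mul_gronwallBound {u : ℝ → ℝ} {K ε T : ℝ} (hu : ContinuousOn u (Icc 0 T))
    (hu₀ : ∀ t ∈ Icc (0 : ℝ) T, 0 ≤ u t)
    (hle : ∀ t ∈ Icc (0 : ℝ) T, u t ≤ K * (∫ s in (0 : ℝ)..t, u s) + ε) :
    ∀ t ∈ Icc (0 : ℝ) T, (∫ s in (0 : ℝ)..t, u s) ≤ ε * gronwallBound 0 K 1 t := by
  intro t ht
  have hT : (0 : ℝ) ≤ T := ht.1.trans ht.2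
  have hint : IntervalIntegrable u volume 0 T := by
    apply ContinuousOn.intervalIntegrable
    rwa [uIcc_of_le hT]
  have hint' : ∀ x ∈ Icc (0 : ℝ) T, IntervalIntegrable u volume 0 x := fun x hx =>
    hint.mono_set (by rw [uIcc_of_le hT, uIcc_of_le hx.1]; exact Icc_subset_Icc_right hx.2)
  have hnonneg : ∀ x ∈ Icc (0 : ℝ) T, 0 ≤ ∫ s in (0 : ℝ)..x, u s := fun x hx =>
    intervalIntegral.integral_nonneg hx.1 fun s hs => hu₀ s ⟨hs.1, hs.2.trans hx.2⟩
  have hderiv : ∀ x ∈ Ico (0 : ℝ) T,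
      HasDerivWithinAt (fun t => ∫ s in (0 : ℝ)..t, u s) (u x) (Ici x) x := by
    intro x hx
    have hcont : ContinuousWithinAt u (Ioi x) x :=
      ((hu x (Ico_subset_Icc_self hx)).mono_of_mem_nhdsWithin
        (Filter.mem_of_superset (Ico_mem_nhdsGE hx.2) fun y hy =>
          ⟨hx.1.trans hy.1, hy.2.le⟩) : ContinuousWithinAt u (Ici x) x).mono Ioi_subset_Ici_self
    refine intervalIntegral.integral_hasDerivWithinAt_right (hint' x (Ico_subset_Icc_self hx))
      (t := Ioi x) ?_ hcont
    exact ⟨Ioo x T, Ioo_mem_nhdsGT hx.2,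
      (hu.mono fun y hy => ⟨hx.1.trans hy.1.le, hy.2.le⟩).aestronglyMeasurable measurableSet_Ioo⟩
  have hcont : ContinuousOn (fun t => ∫ s in (0 : ℝ)..t, u s) (Icc 0 T) := by
    have := intervalIntegral.continuousOn_primitive_interval (μ := volume) (f := u)
      (a := 0) (b := T) (by rw [uIcc_of_le hT]; exact hu.integrableOn_Icc)
    rwa [uIcc_of_le hT] at this
  have hbound := norm_le_gronwallBound_of_norm_deriv_right_le (δ := 0) (K := K) (ε := ε) hcont
    hderiv (by simp) (fun x hx => by
      have hx' := Ico_subset_Icc_self hx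
      rw [Real.norm_of_nonneg (hu₀ x hx'), Real.norm_of_nonneg (hnonneg x hx')]
      exact hle x hx') t ht
  have hscale : gronwallBound 0 K ε t = ε * gronwallBound 0 K 1 t := by
    rcases eq_or_ne K 0 with rfl | hK
    · simp [gronwallBound_K0]
    · simp only [gronwallBound_of_K_ne_0 hK]
      ring
  rw [sub_zero, hscale] at hbound
  exact (le_abs_self _).trans hbound

lemma intervalIntegrable_comp_sub {F : ℝ → ℝ → ℝ} {z : ℝ → ℝ} {M t : ℝ} (ht : 0 ≤ t)
    (hF : Measurable (Function.uncurry F)) (hM : ∀ x, ∀ s ∈ Icc (0 : ℝ) t, |F x s| ≤ M)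
    (hz : ContinuousOn z (Icc 0 t)) (c : ℝ) :
    IntervalIntegrable (fun s => F (c - z s) s) volume 0 t := by
  rw [intervalIntegrable_iff_integrableOn_Icc_of_le ht]
  refine IntegrableOn.of_bound (C := M) measure_Icc_lt_top ?_ ?_
  · have hz' : AEMeasurable z (volume.restrict (Icc 0 t)) := hz.aemeasurable measurableSet_Icc
    exact (hF.comp_aemeasurable ((hz'.const_sub c).prodMk aemeasurable_id)).aestronglyMeasurable
  · exact (ae_restrict_iff' measurableSet_Icc).2 (.of_forall fun s hs => hM _ s hs)

/-- Lipschitz continuous dependence of the solution of the bathtub system on the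
initial condition `h` and the demand `F̄`: there is a constant `C` depending only on
`T̄`, `Vmin`, `Vmax`, the Lipschitz constants of `V`, `h₁` and of `F̄₁` (in its first
argument), and the uniform bound on `F̄₁`, such that for any two solutions
`(z₁, H₁)`, `(z₂, H₂)` with data `(h₁, F̄₁)`, `(h₂, F̄₂)`, the uniform distance of the
solutions is bounded by `C` times the sum of the uniform distances of the data. -/
theorem bathtub_lipschitz_dependence_on_data
    (Tbar Vmin Vmax : ℝ) (LV Lh LF : NNReal) (MF : ℝ)
    (hT : 0 < Tbar) (hVmin : 0 < Vmin) (hVV : Vmin ≤ Vmax) :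
    ∃ C : ℝ,
      ∀ (V h₁ h₂ : ℝ → ℝ) (F₁ F₂ : ℝ → ℝ → ℝ) (z₁ H₁ z₂ H₂ : ℝ → ℝ) (δh δF : ℝ),
        -- regularity and bounds of `V`
        LipschitzWith LV V → (∀ y, Vmin ≤ V y ∧ V y ≤ Vmax) →
        -- regularity and bounds of the first data pair (with the fixed constants)
        (∃ M₁ : ℝ, ∀ x, |h₁ x| ≤ M₁) → LipschitzWith Lh h₁ →
        (∀ x : ℝ, ∀ s ∈ Icc (0 : ℝ) Tbar, |F₁ x s| ≤ MF) →
        Measurable (Function.uncurry F₁) →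
        (∀ s ∈ Icc (0 : ℝ) Tbar, LipschitzWith LF (fun x => F₁ x s)) →
        -- regularity and bounds of the second data pair (with some constants)
        (∃ M₂ : ℝ, ∀ x, |h₂ x| ≤ M₂) → (∃ L₂ : NNReal, LipschitzWith L₂ h₂) →
        (∃ M₂' : ℝ, ∀ x : ℝ, ∀ s ∈ Icc (0 : ℝ) Tbar, |F₂ x s| ≤ M₂') →
        Measurable (Function.uncurry F₂) →
        (∃ L₂' : NNReal, ∀ s ∈ Icc (0 : ℝ) Tbar, LipschitzWith L₂' (fun x => F₂ x s)) →
        -- `(z₁, H₁)` solves the bathtub system with data `(h₁, F₁)`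
        ContinuousOn z₁ (Icc 0 Tbar) → ContinuousOn H₁ (Icc 0 Tbar) →
        (∀ t ∈ Icc (0 : ℝ) Tbar, z₁ t = ∫ s in (0 : ℝ)..t, V (H₁ s)) →
        (∀ t ∈ Icc (0 : ℝ) Tbar, H₁ t = h₁ (z₁ t) + ∫ s in (0 : ℝ)..t, F₁ (z₁ t - z₁ s) s) →
        -- `(z₂, H₂)` solves the bathtub system with data `(h₂, F₂)`
        ContinuousOn z₂ (Icc 0 Tbar) → ContinuousOn H₂ (Icc 0 Tbar) →
        (∀ t ∈ Icc (0 : ℝ) Tbar, z₂ t = ∫ s in (0 : ℝ)..t, V (H₂ s)) →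
        (∀ t ∈ Icc (0 : ℝ) Tbar, H₂ t = h₂ (z₂ t) + ∫ s in (0 : ℝ)..t, F₂ (z₂ t - z₂ s) s) →
        -- uniform bounds on the differences of the data
        (∀ x : ℝ, |h₁ x - h₂ x| ≤ δh) →
        (∀ x : ℝ, ∀ s ∈ Icc (0 : ℝ) Tbar, |F₁ x s - F₂ x s| ≤ δF) →
        -- conclusion: uniform Lipschitz estimate on the solutions
        ∀ t ∈ Icc (0 : ℝ) Tbar, |z₁ t - z₂ t| + |H₁ t - H₂ t| ≤ C * (δh + δF) := by
  set K : ℝ := (Lh + 2 * LF * Tbar) * LV with hK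
  have hK₀ : 0 ≤ K := by positivity
  refine ⟨((LV + K) * gronwallBound 0 K 1 Tbar + 1) * (1 + Tbar), ?_⟩
  intro V h₁ h₂ F₁ F₂ z₁ H₁ z₂ H₂ δh δF hV _ _ hh₁ hF₁ hF₁m hF₁L _ _ ⟨M₂, hF₂⟩ hF₂m _
    hz₁ hH₁ hz₁eq hH₁eq hz₂ hH₂ hz₂eq hH₂eq hδh hδF
  have hδh₀ : 0 ≤ δh := (abs_nonneg _).trans (hδh 0)
  have hδF₀ : 0 ≤ δF := (abs_nonneg _).trans (hδF 0 0 ⟨le_rfl, hT.le⟩)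
  set u : ℝ → ℝ := fun s => |H₁ s - H₂ s| with hu
  have huc : ContinuousOn u (Icc 0 Tbar) := (hH₁.sub hH₂).abs
  have hint : ∀ {f : ℝ → ℝ}, ContinuousOn f (Icc 0 Tbar) → ∀ t ∈ Icc (0 : ℝ) Tbar,
      IntervalIntegrable f volume 0 t := fun hf t ht => by
    apply ContinuousOn.intervalIntegrable
    rw [uIcc_of_le ht.1]
    exact hf.mono (Icc_subset_Icc_right ht.2)
  have hz : ∀ t ∈ Icc (0 : ℝ) Tbar, |z₁ t - z₂ t| ≤ LV * ∫ s in (0 : ℝ)..t, u s := by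
    intro t ht
    rw [hz₁eq t ht, hz₂eq t ht, ← intervalIntegral.integral_sub
      (hint (hV.continuous.comp_continuousOn' hH₁) t ht)
      (hint (hV.continuous.comp_continuousOn' hH₂) t ht), ← intervalIntegral.integral_const_mul,
      ← Real.norm_eq_abs]
    refine intervalIntegral.norm_integral_le_of_norm_le ht.1 (.of_forall fun s _ => ?_)
      ((hint huc t ht).const_mul _)
    simpa [Real.dist_eq] using hV.dist_le_mul (H₁ s) (H₂ s)
  have hmono : ∀ t ∈ Icc (0 : ℝ) Tbar, ∀ s ∈ Icc (0 : ℝ) t,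
      (∫ r in (0 : ℝ)..s, u r) ≤ ∫ r in (0 : ℝ)..t, u r := fun t ht s hs =>
    intervalIntegral.integral_mono_interval le_rfl hs.1 hs.2
      (.of_forall fun r => abs_nonneg _) (hint huc t ht)
  have hH : ∀ t ∈ Icc (0 : ℝ) Tbar,
      u t ≤ K * (∫ s in (0 : ℝ)..t, u s) + (δh + Tbar * δF) := by
    intro t ht
    set I := ∫ s in (0 : ℝ)..t, u s
    have hI₀ : 0 ≤ I := intervalIntegral.integral_nonneg ht.1 fun s _ => abs_nonneg _
    have hsub : Icc 0 t ⊆ Icc 0 Tbar := Icc_subset_Icc_right ht.2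
    have hh : |h₁ (z₁ t) - h₂ (z₂ t)| ≤ Lh * (LV * I) + δh := by
      calc |h₁ (z₁ t) - h₂ (z₂ t)|
          ≤ |h₁ (z₁ t) - h₁ (z₂ t)| + |h₁ (z₂ t) - h₂ (z₂ t)| := abs_sub_le _ _ _
        _ ≤ Lh * |z₁ t - z₂ t| + δh := add_le_add (hh₁.dist_le_mul _ _) (hδh _)
        _ ≤ Lh * (LV * I) + δh := by gcongr; exact hz t ht
    have hF : |(∫ s in (0 : ℝ)..t, F₁ (z₁ t - z₁ s) s) - ∫ s in (0 : ℝ)..t, F₂ (z₂ t - z₂ s) s|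
        ≤ (2 * LF * (LV * I) + δF) * Tbar := by
      rw [← intervalIntegral.integral_sub
        (intervalIntegrable_comp_sub ht.1 hF₁m (fun x s hs => hF₁ x s (hsub hs)) (hz₁.mono hsub) _)
        (intervalIntegrable_comp_sub ht.1 hF₂m (fun x s hs => hF₂ x s (hsub hs)) (hz₂.mono hsub) _), ← Real.norm_eq_abs]
      refine (intervalIntegral.norm_integral_le_of_norm_le_const
        (C := 2 * LF * (LV * I) + δF) fun s hs => ?_).trans ?_
      · rw [uIoc_of_le ht.1] at hs
        have hs' := Ioc_subset_Icc_self hs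
        have hdist : |(z₁ t - z₁ s) - (z₂ t - z₂ s)| ≤ 2 * (LV * I) := by
          have hzs : |z₁ s - z₂ s| ≤ LV * I :=
            (hz s (hsub hs')).trans (by gcongr; exact hmono t ht s hs')
          rw [sub_sub_sub_comm]
          linarith [abs_sub (z₁ t - z₂ t) (z₁ s - z₂ s), hz t ht]
        calc |F₁ (z₁ t - z₁ s) s - F₂ (z₂ t - z₂ s) s|
            ≤ |F₁ (z₁ t - z₁ s) s - F₁ (z₂ t - z₂ s) s|
              + |F₁ (z₂ t - z₂ s) s - F₂ (z₂ t - z₂ s) s| := abs_sub_le _ _ _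
          _ ≤ LF * |(z₁ t - z₁ s) - (z₂ t - z₂ s)| + δF :=
            add_le_add ((hF₁L s (hsub hs')).dist_le_mul _ _) (hδF _ _ (hsub hs'))
          _ ≤ LF * (2 * (LV * I)) + δF := by gcongr
          _ = 2 * LF * (LV * I) + δF := by ring
      · rw [sub_zero, abs_of_nonneg ht.1]
        gcongr
        exact ht.2
    calc u t = |(h₁ (z₁ t) - h₂ (z₂ t)) + ((∫ s in (0 : ℝ)..t, F₁ (z₁ t - z₁ s) s)
            - ∫ s in (0 : ℝ)..t, F₂ (z₂ t - z₂ s) s)| := by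
          rw [hu]
          simp only [hH₁eq t ht, hH₂eq t ht]
          congr 1
          ring
      _ ≤ (Lh * (LV * I) + δh) + (2 * LF * (LV * I) + δF) * Tbar :=
          (abs_add_le _ _).trans (add_le_add hh hF)
      _ = K * I + (δh + Tbar * δF) := by rw [hK]; ring
  intro t ht
  have hgron := integral_le_mul_gronwallBound huc (fun s _ => abs_nonneg _) hH t ht
  have hG : gronwallBound 0 K 1 t ≤ gronwallBound 0 K 1 Tbar :=
    gronwallBound_mono le_rfl zero_le_one hK₀ ht.2
  have hG₀ : 0 ≤ gronwallBound 0 K 1 Tbar := by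
    simpa [gronwallBound_x0] using gronwallBound_mono le_rfl zero_le_one hK₀ hT.le
  calc |z₁ t - z₂ t| + |H₁ t - H₂ t|
      ≤ LV * (∫ s in (0 : ℝ)..t, u s) + (K * (∫ s in (0 : ℝ)..t, u s) + (δh + Tbar * δF)) :=
        add_le_add (hz t ht) (hH t ht)
    _ = (LV + K) * (∫ s in (0 : ℝ)..t, u s) + (δh + Tbar * δF) := by ring
    _ ≤ (LV + K) * ((δh + Tbar * δF) * gronwallBound 0 K 1 Tbar) + (δh + Tbar * δF) := by
        gcongr
        exact hgron.trans (by gcongr)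
    _ = ((LV + K) * gronwallBound 0 K 1 Tbar + 1) * (δh + Tbar * δF) := by ring
    _ ≤ ((LV + K) * gronwallBound 0 K 1 Tbar + 1) * ((1 + Tbar) * (δh + δF)) := by
        gcongr
        nlinarith [mul_nonneg hT.le hδh₀]
    _ = ((LV + K) * gronwallBound 0 K 1 Tbar + 1) * (1 + Tbar) * (δh + δF) := by ring
end

section
/- The travel time T(t_d, x) := z⁻¹(x + z(t_d)) − t_d is jointly Lipschitz in (t_d, x): for all t_d, t_d' ∈ [0,T̄] and x, x' ≥ 0 with x + z(t_d) ≤ z(T̄) and x' + z(t_d') ≤ z(T̄), |T(t_d, x) − T(t_d', x')| ≤ (1/Vmin)·|x − x'| + (1 + Vmax/Vmin)·|t_d − t_d'|. -/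
open MeasureTheory Set

/-- Almost everywhere bounds on an integrand bound the increments of its primitive. -/
theorem intervalIntegral_increment_bounds {T m M : ℝ} {v : ℝ → ℝ}
    (hv : IntervalIntegrable v volume 0 T)
    (hb : ∀ᵐ s ∂(volume : Measure ℝ), s ∈ Icc (0 : ℝ) T → m ≤ v s ∧ v s ≤ M)
    {a b : ℝ} (ha : 0 ≤ a) (hab : a ≤ b) (hbT : b ≤ T) :
    m * (b - a) ≤ (∫ s in (0 : ℝ)..b, v s) - ∫ s in (0 : ℝ)..a, v s ∧
      (∫ s in (0 : ℝ)..b, v s) - ∫ s in (0 : ℝ)..a, v s ≤ M * (b - a) := by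
  have hsub : ∀ {c d : ℝ}, 0 ≤ c → c ≤ d → d ≤ T → IntervalIntegrable v volume c d := by
    intro c d hc hcd hd
    refine hv.mono_set ?_
    rw [uIcc_of_le hcd, uIcc_of_le (hc.trans (hcd.trans hd))]
    exact Icc_subset_Icc hc hd
  have hi := hsub ha hab hbT
  rw [intervalIntegral.integral_interval_sub_left (hsub le_rfl (ha.trans hab) hbT)
    (hsub le_rfl ha (hab.trans hbT))]
  have hb' : ∀ᵐ s ∂(volume.restrict (Icc a b)), m ≤ v s ∧ v s ≤ M := by
    rw [ae_restrict_iff' measurableSet_Icc]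
    filter_upwards [hb] with s hs hmem
    exact hs ⟨ha.trans hmem.1, hmem.2.trans hbT⟩
  constructor
  · have h := intervalIntegral.integral_mono_ae_restrict hab
      (intervalIntegrable_const (c := m)) hi (hb'.mono fun _ h => h.1)
    rw [intervalIntegral.integral_const, smul_eq_mul] at h
    linarith
  · have h := intervalIntegral.integral_mono_ae_restrict hab
      hi (intervalIntegrable_const (c := M)) (hb'.mono fun _ h => h.2)
    rw [intervalIntegral.integral_const, smul_eq_mul] at h
    linarith

/-- Joint Lipschitz continuity of the travel time `T(t_d, x) = z⁻¹(x + z(t_d)) − t_d`: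
`|T(t_d, x) − T(t_d', x')| ≤ (1/Vmin)·|x − x'| + (1 + Vmax/Vmin)·|t_d − t_d'|`
for all admissible `(t_d, x)` and `(t_d', x')`. -/
theorem travel_time_jointly_lipschitz
    (Tbar Vmin Vmax : ℝ) (hT : 0 < Tbar) (hVmin : 0 < Vmin) (hVV : Vmin ≤ Vmax)
    (v : ℝ → ℝ) (hvInt : IntervalIntegrable v volume 0 Tbar)
    (hvb : ∀ᵐ s ∂(volume : Measure ℝ), s ∈ Icc (0 : ℝ) Tbar → Vmin ≤ v s ∧ v s ≤ Vmax)
    (z : ℝ → ℝ) (hz : ∀ t, z t = ∫ s in (0 : ℝ)..t, v s)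
    (TT : ℝ → ℝ → ℝ)
    (hTT : ∀ td x : ℝ, TT td x = Function.invFunOn z (Icc 0 Tbar) (x + z td) - td) :
    ∀ td ∈ Icc (0 : ℝ) Tbar, ∀ td' ∈ Icc (0 : ℝ) Tbar, ∀ x x' : ℝ,
      0 ≤ x → 0 ≤ x' → x + z td ≤ z Tbar → x' + z td' ≤ z Tbar →
      |TT td x - TT td' x'| ≤ (1 / Vmin) * |x - x'| + (1 + Vmax / Vmin) * |td - td'| := by
  have hinc : ∀ a ∈ Icc (0 : ℝ) Tbar, ∀ b ∈ Icc (0 : ℝ) Tbar, a ≤ b →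
      Vmin * (b - a) ≤ z b - z a ∧ z b - z a ≤ Vmax * (b - a) := by
    intro a ha b hb hab
    rw [hz a, hz b]
    exact intervalIntegral_increment_bounds hvInt hvb ha.1 hab hb.2
  have hlower : ∀ a ∈ Icc (0 : ℝ) Tbar, ∀ b ∈ Icc (0 : ℝ) Tbar,
      Vmin * |a - b| ≤ |z a - z b| := by
    intro a ha b hb
    rcases le_total a b with h | h
    · rw [abs_sub_comm a b, abs_sub_comm (z a), abs_of_nonneg (sub_nonneg.2 h)]
      exact (hinc a ha b hb h).1.trans (le_abs_self _)
    · rw [abs_of_nonneg (sub_nonneg.2 h)]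
      exact (hinc b hb a ha h).1.trans (le_abs_self _)
  have hupper : ∀ a ∈ Icc (0 : ℝ) Tbar, ∀ b ∈ Icc (0 : ℝ) Tbar,
      |z a - z b| ≤ Vmax * |a - b| := by
    intro a ha b hb
    rcases le_total a b with h | h
    · obtain ⟨h₁, h₂⟩ := hinc a ha b hb h
      rw [abs_sub_comm a b, abs_sub_comm (z a), abs_of_nonneg (sub_nonneg.2 h),
        abs_of_nonneg ((mul_nonneg hVmin.le (sub_nonneg.2 h)).trans h₁)]
      exact h₂
    · obtain ⟨h₁, h₂⟩ := hinc b hb a ha h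
      rw [abs_of_nonneg (sub_nonneg.2 h),
        abs_of_nonneg ((mul_nonneg hVmin.le (sub_nonneg.2 h)).trans h₁)]
      exact h₂
  have hcont : ContinuousOn z (Icc 0 Tbar) := by
    refine (LipschitzOnWith.of_dist_le_mul (K := ⟨Vmax, hVmin.le.trans hVV⟩) ?_).continuousOn
    intro a ha b hb
    exact hupper a ha b hb
  have h0 : z 0 = 0 := by rw [hz, intervalIntegral.integral_same]
  have hsurj : ∀ td ∈ Icc (0 : ℝ) Tbar, ∀ x : ℝ, 0 ≤ x → x + z td ≤ z Tbar →
      x + z td ∈ z '' Icc 0 Tbar := by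
    intro td htd x hx hle
    refine intermediate_value_Icc hT.le hcont ⟨?_, hle⟩
    have h := (hinc 0 ⟨le_rfl, hT.le⟩ td htd htd.1).1
    have h' := mul_nonneg hVmin.le (sub_nonneg.2 htd.1)
    linarith
  intro td htd td' htd' x x' hx hx' hle hle'
  have hs := hsurj td htd x hx hle
  have hs' := hsurj td' htd' x' hx' hle'
  rw [hTT, hTT]
  have hm := Function.invFunOn_mem hs
  have hm' := Function.invFunOn_mem hs'
  have he := Function.invFunOn_eq hs
  have he' := Function.invFunOn_eq hs'
  set p := Function.invFunOn z (Icc 0 Tbar) (x + z td)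
  set q := Function.invFunOn z (Icc 0 Tbar) (x' + z td')
  have hpq : Vmin * |p - q| ≤ |x - x'| + Vmax * |td - td'| := by
    calc Vmin * |p - q| ≤ |z p - z q| := hlower p hm q hm'
      _ = |(x - x') + (z td - z td')| := by rw [he, he']; ring_nf
      _ ≤ |x - x'| + |z td - z td'| := abs_add_le _ _
      _ ≤ |x - x'| + Vmax * |td - td'| := by gcongr; exact hupper td htd td' htd'
  calc |p - td - (q - td')| = |(p - q) - (td - td')| := by ring_nf
    _ ≤ |p - q| + |td - td'| := abs_sub _ _
    _ ≤ (|x - x'| + Vmax * |td - td'|) / Vmin + |td - td'| := by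
      gcongr
      rwa [le_div_iff₀' hVmin]
    _ = (1 / Vmin) * |x - x'| + (1 + Vmax / Vmin) * |td - td'| := by ring
end

section
/- Let z₁, z₂ : [0,T̄] → ℝ be continuous functions with z₁(0) = z₂(0) = 0 such that z_i(t) − z_i(s) ≥ Vmin·(t − s) for all 0 ≤ s ≤ t ≤ T̄ and i = 1, 2, where Vmin > 0. Then for every x ∈ [0, min(z₁(T̄), z₂(T̄))], the inverse functions satisfy |z₁⁻¹(x) − z₂⁻¹(x)| ≤ (1/Vmin)·sup_{t∈[0,T̄]} |z₁(t) − z₂(t)|. In particular the inverse characteristic travel distance depends Lipschitz continuously on the characteristic travel distance in the uniform norm. -/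
open MeasureTheory Set

/-- If `u` and `v` are `δ`-close at `a`, `v` grows at average rate at least `c` from `a` to `b` and `u a = v b`,
then `b` exceeds `a` by at most `δ / c`. -/
theorem sub_le_div_of_growth_of_eq {c δ a b : ℝ} {u v : ℝ → ℝ} (hc : 0 < c)
    (hgrowth : c * (b - a) ≤ v b - v a) (hclose : |u a - v a| ≤ δ) (hab : u a = v b) :
    b - a ≤ δ / c := by
  rw [le_div_iff₀ hc]
  linarith [le_abs_self (u a - v a)]

/-- Lipschitz dependence of the inverse characteristic travel distance on the
characteristic travel distance in the uniform norm: if `z₁, z₂` are continuous on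
`[0, T̄]`, vanish at `0`, and satisfy `z_i(t) − z_i(s) ≥ Vmin·(t − s)`, then for
every `x ∈ [0, min(z₁(T̄), z₂(T̄))]`,
`|z₁⁻¹(x) − z₂⁻¹(x)| ≤ (1/Vmin)·sup_{t∈[0,T̄]} |z₁(t) − z₂(t)|`. -/
theorem inverse_characteristic_distance_lipschitz_dependence
    (Tbar Vmin : ℝ) (hT : 0 < Tbar) (hVmin : 0 < Vmin)
    (z₁ z₂ : ℝ → ℝ)
    (hc₁ : ContinuousOn z₁ (Icc 0 Tbar)) (hc₂ : ContinuousOn z₂ (Icc 0 Tbar))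
    (h0₁ : z₁ 0 = 0) (h0₂ : z₂ 0 = 0)
    (hg₁ : ∀ s t : ℝ, 0 ≤ s → s ≤ t → t ≤ Tbar → Vmin * (t - s) ≤ z₁ t - z₁ s)
    (hg₂ : ∀ s t : ℝ, 0 ≤ s → s ≤ t → t ≤ Tbar → Vmin * (t - s) ≤ z₂ t - z₂ s)
    (δ : ℝ) (hδ : ∀ t ∈ Icc (0 : ℝ) Tbar, |z₁ t - z₂ t| ≤ δ) :
    ∀ x ∈ Icc (0 : ℝ) (min (z₁ Tbar) (z₂ Tbar)),
      |Function.invFunOn z₁ (Icc 0 Tbar) x - Function.invFunOn z₂ (Icc 0 Tbar) x|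
        ≤ δ / Vmin := by
  intro x hx
  have hx₁ : x ∈ z₁ '' Icc 0 Tbar :=
    intermediate_value_Icc hT.le hc₁ ⟨h0₁.trans_le hx.1, hx.2.trans (min_le_left _ _)⟩
  have hx₂ : x ∈ z₂ '' Icc 0 Tbar :=
    intermediate_value_Icc hT.le hc₂ ⟨h0₂.trans_le hx.1, hx.2.trans (min_le_right _ _)⟩
  have ha := Function.invFunOn_mem hx₁
  have hza := Function.invFunOn_eq hx₁
  have hb := Function.invFunOn_mem hx₂
  have hzb := Function.invFunOn_eq hx₂
  set a := Function.invFunOn z₁ (Icc 0 Tbar) x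
  set b := Function.invFunOn z₂ (Icc 0 Tbar) x
  rcases le_total a b with hab | hba
  · rw [abs_sub_comm, abs_of_nonneg (sub_nonneg.2 hab)]
    exact sub_le_div_of_growth_of_eq hVmin (hg₂ a b ha.1 hab hb.2) (hδ a ha)
      (hza.trans hzb.symm)
  · rw [abs_of_nonneg (sub_nonneg.2 hba)]
    exact sub_le_div_of_growth_of_eq hVmin (hg₁ b a hb.1 hba ha.2)
      (abs_sub_comm (z₁ b) (z₂ b) ▸ hδ b hb) (hzb.trans hza.symm)
end

section
/- Let μ be a finite measure on a measurable space Ω and g ∈ L¹(μ), and define Φ(ς) = ∫_Ω max(g(ω) + ς, 0) dμ(ω). If m > 0 and ς₁, ς₂ ∈ ℝ satisfy Φ(ς₁) = Φ(ς₂) = m, then ς₁ = ς₂; that is, the Lagrange multiplier solving the mass equation Φ(ς) = m is unique for every positive mass m. -/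
open MeasureTheory

/-- The truncated mass `ς ↦ ∫ max(g + ς, 0) dμ` is strictly increasing where it is positive. -/
theorem integral_max_add_lt_of_pos
    {Ω : Type*} [MeasurableSpace Ω] {μ : Measure Ω} [IsFiniteMeasure μ]
    {g : Ω → ℝ} (hg : Integrable g μ) {a b : ℝ} (hab : a < b)
    (ha : 0 < ∫ ω, max (g ω + a) 0 ∂μ) :
    ∫ ω, max (g ω + a) 0 ∂μ < ∫ ω, max (g ω + b) 0 ∂μ := by
  have hint : ∀ c : ℝ, Integrable (fun ω => max (g ω + c) 0) μ := fun c =>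
    (hg.add (integrable_const c)).pos_part
  have hle : ∀ ω, max (g ω + a) 0 ≤ max (g ω + b) 0 := fun ω => by gcongr
  refine (integral_mono (hint a) (hint b) hle).lt_of_ne fun heq => ha.ne' ?_
  have hae := (integral_eq_iff_of_ae_le (hint a) (hint b) (.of_forall hle)).1 heq
  refine integral_eq_zero_of_ae ?_
  filter_upwards [hae] with ω hω
  simp only [Pi.zero_apply]
  grind

/-- Uniqueness of the Lagrange multiplier: if `Φ(ς) = ∫ max(g + ς, 0) dμ` and
`Φ(ς₁) = Φ(ς₂) = m` with `m > 0`, then `ς₁ = ς₂`. -/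
theorem lagrange_multiplier_unique
    {Ω : Type*} [MeasurableSpace Ω] (μ : Measure Ω) [IsFiniteMeasure μ]
    (g : Ω → ℝ) (hg : Integrable g μ)
    (Φ : ℝ → ℝ) (hΦ : ∀ ς, Φ ς = ∫ ω, max (g ω + ς) 0 ∂μ)
    (m : ℝ) (hm : 0 < m) (ς₁ ς₂ : ℝ) (h₁ : Φ ς₁ = m) (h₂ : Φ ς₂ = m) :
    ς₁ = ς₂ := by
  rw [hΦ] at h₁ h₂
  rcases lt_trichotomy ς₁ ς₂ with h | h | h
  · exact absurd (h₁.trans h₂.symm) (integral_max_add_lt_of_pos hg h (h₁ ▸ hm)).ne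
  · exact h
  · exact absurd (h₂.trans h₁.symm) (integral_max_add_lt_of_pos hg h (h₂ ▸ hm)).ne
end

section
/- Let z, w : ℝ → ℝ be continuously differentiable with z'(τ) ≥ Vmin > 0 for all τ. Fix t, x ∈ ℝ and suppose τ : (−ε₀, ε₀) → ℝ is differentiable and satisfies z(τ(ε)) + ε·w(τ(ε)) = x + z(t) + ε·w(t) for all ε ∈ (−ε₀, ε₀). Then τ'(0) = ( w(t) − w(τ(0)) ) / z'(τ(0)). -/
open Set

/-- First-order variation of the arrival time: if `τ(ε)` is defined implicitly by
`(z + ε·w)(τ(ε)) = x + (z + ε·w)(t)` on `(−ε₀, ε₀)`, with `z, w` continuously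
differentiable and `z' ≥ Vmin > 0`, then `τ'(0) = (w(t) − w(τ(0))) / z'(τ(0))`. -/
theorem arrival_time_first_order_variation
    (Vmin : ℝ) (hVmin : 0 < Vmin)
    (z z' w w' : ℝ → ℝ)
    (hz : ∀ τ, HasDerivAt z (z' τ) τ) (hz'c : Continuous z')
    (hw : ∀ τ, HasDerivAt w (w' τ) τ) (hw'c : Continuous w')
    (hzlb : ∀ τ : ℝ, Vmin ≤ z' τ)
    (t x : ℝ) (ε₀ : ℝ) (hε₀ : 0 < ε₀)
    (τ : ℝ → ℝ)
    (hτdiff : ∀ ε ∈ Ioo (-ε₀) ε₀, DifferentiableAt ℝ τ ε)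
    (heq : ∀ ε ∈ Ioo (-ε₀) ε₀, z (τ ε) + ε * w (τ ε) = x + z t + ε * w t) :
    deriv τ 0 = (w t - w (τ 0)) / z' (τ 0) := by
  have h0 : (0 : ℝ) ∈ Ioo (-ε₀) ε₀ := ⟨neg_lt_zero.mpr hε₀, hε₀⟩
  have hτ : HasDerivAt τ (deriv τ 0) 0 := (hτdiff 0 h0).hasDerivAt
  have hleft : HasDerivAt (fun ε => z (τ ε) + ε * w (τ ε))
      (z' (τ 0) * deriv τ 0 + (1 * w (τ 0) + 0 * (w' (τ 0) * deriv τ 0))) 0 :=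
    ((hz (τ 0)).comp 0 hτ).add ((hasDerivAt_id' 0).mul ((hw (τ 0)).comp 0 hτ))
  have hright : HasDerivAt (fun ε => x + z t + ε * w t) (1 * w t) 0 :=
    ((hasDerivAt_id' 0).mul_const (w t)).const_add (x + z t)
  have hloc : (fun ε => z (τ ε) + ε * w (τ ε)) =ᶠ[nhds 0] fun ε => x + z t + ε * w t :=
    Filter.eventually_of_mem (isOpen_Ioo.mem_nhds h0) heq
  have hderiv := hleft.unique (hright.congr_of_eventuallyEq hloc)
  rw [eq_div_iff (hVmin.trans_le (hzlb (τ 0))).ne']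
  linarith
end
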